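/- Let (uₙ) ⊂ H¹(ℝ^N) be bounded, and suppose that for every ε > 0 there exists R(ε) > 0 such that limsup_{n→∞} sup_{x ∈ ℝ^N \ B(0,R(ε))} ∫_{B(x,1)} |uₙ|² dx ≤ ε. Assume F : ℝ → ℝ satisfies |F(t)| ≤ M(|t|^p + |t|^q) with 2 < p, q < 2N/(N−2) and F continuous, and that uₙ ⇀ u in H¹(ℝ^N). Then ∫_{ℝ^N} F(uₙ) dx → ∫_{ℝ^N} F(u) dx. -/

import Mathlib

open MeasureTheory Filter RealInnerProductSpace

noncomputable section

open scoped ENNReal NNReal Topology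

section LebesgueIntegral

variable {α : Type*} [MeasurableSpace α]

/-- Jensen's inequality for powers, for a measure of arbitrary mass. -/
lemma lintegral_rpow_le_measure_univ_mul (ν : Measure α) {p : ℝ} (hp : 1 < p) {f : α → ℝ≥0∞}
    (hf : Measurable f) :
    (∫⁻ a, f a ∂ν) ^ p ≤ ν Set.univ ^ (p - 1) * ∫⁻ a, f a ^ p ∂ν := by
  have hpq := Real.HolderConjugate.conjExponent hp
  have h := ENNReal.lintegral_mul_le_Lp_mul_Lq ν hpq hf.aemeasurable
    (measurable_const (a := (1 : ℝ≥0∞))).aemeasurable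
  simp only [Pi.mul_apply, mul_one, ENNReal.one_rpow, lintegral_const, one_mul] at h
  have h0 : 0 < p := by linarith
  calc (∫⁻ a, f a ∂ν) ^ p
      ≤ ((∫⁻ a, f a ^ p ∂ν) ^ (1 / p) * ν Set.univ ^ (1 / p.conjExponent)) ^ p :=
        ENNReal.rpow_le_rpow h h0.le
    _ = ν Set.univ ^ (p - 1) * ∫⁻ a, f a ^ p ∂ν := by
        rw [ENNReal.mul_rpow_of_nonneg _ _ h0.le, ← ENNReal.rpow_mul, ← ENNReal.rpow_mul,
          one_div_mul_cancel h0.ne', ENNReal.rpow_one, mul_comm]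
        congr 2
        rw [Real.conjExponent]
        have : p - 1 ≠ 0 := by linarith
        field_simp

/-- Jensen's inequality for powers with respect to a weight. -/
lemma lintegral_mul_rpow_le (μ : Measure α) {p : ℝ} (hp : 1 < p) {w f : α → ℝ≥0∞}
    (hw : Measurable w) (hf : Measurable f) :
    (∫⁻ a, w a * f a ∂μ) ^ p ≤ (∫⁻ a, w a ∂μ) ^ (p - 1) * ∫⁻ a, w a * f a ^ p ∂μ := by
  have h := lintegral_rpow_le_measure_univ_mul (μ.withDensity w) hp hf
  rw [lintegral_withDensity_eq_lintegral_mul μ hw hf,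
    lintegral_withDensity_eq_lintegral_mul μ hw (hf.pow_const p),
    withDensity_apply _ MeasurableSet.univ, Measure.restrict_univ] at h
  simpa using h

/-- Jensen's inequality for powers, for a probability measure. -/
lemma lintegral_rpow_le (ν : Measure α) [IsProbabilityMeasure ν] {p : ℝ} (hp : 1 < p)
    {f : α → ℝ≥0∞} (hf : Measurable f) :
    (∫⁻ a, f a ∂ν) ^ p ≤ ∫⁻ a, f a ^ p ∂ν := by
  simpa using lintegral_rpow_le_measure_univ_mul ν hp hf

/-- A weighted form of Minkowski's integral inequality. -/
lemma lintegral_rpow_lintegral_le {β : Type*} [MeasurableSpace β] (μ : Measure α) (κ : Measure β)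
    [SFinite μ] [SFinite κ] {p : ℝ} (hp : 1 < p) {A : α → β → ℝ≥0∞}
    (hA : Measurable fun t : α × β => A t.1 t.2) {w : β → ℝ≥0∞} (hw : Measurable w)
    (hw0 : ∀ᵐ b ∂κ, w b ≠ 0 ∧ w b ≠ ∞) {K : ℝ≥0∞}
    (hK : ∀ᵐ b ∂κ, ∫⁻ a, A a b ^ p ∂μ ≤ w b ^ p * K) :
    ∫⁻ a, (∫⁻ b, A a b ∂κ) ^ p ∂μ ≤ (∫⁻ b, w b ∂κ) ^ p * K := by
  have hp0 : 0 < p := by linarith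
  have hF : Measurable fun t : α × β => w t.2 * ((w t.2)⁻¹ * A t.1 t.2) ^ p :=
    (hw.comp measurable_snd).mul (((hw.inv.comp measurable_snd).mul hA).pow_const p)
  have hpt : ∀ a, (∫⁻ b, A a b ∂κ) ^ p ≤
      (∫⁻ b, w b ∂κ) ^ (p - 1) * ∫⁻ b, w b * ((w b)⁻¹ * A a b) ^ p ∂κ := fun a => by
    have hAa : Measurable fun b => A a b := hA.comp measurable_prodMk_left
    refine le_trans (ENNReal.rpow_le_rpow (le_of_eq ?_) hp0.le)
      (lintegral_mul_rpow_le κ hp hw (hw.inv.mul hAa))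
    refine lintegral_congr_ae (hw0.mono fun b hb => ?_)
    change A a b = w b * ((w b)⁻¹ * A a b)
    rw [← mul_assoc, ENNReal.mul_inv_cancel hb.1 hb.2, one_mul]
  have hin : ∀ᵐ b ∂κ, ∫⁻ a, w b * ((w b)⁻¹ * A a b) ^ p ∂μ ≤ w b * K := by
    filter_upwards [hw0, hK] with b hb hKb
    have hAb : Measurable fun a => A a b := hA.comp measurable_prodMk_right
    rw [lintegral_const_mul _ ((hAb.const_mul _).pow_const _)]
    simp_rw [ENNReal.mul_rpow_of_nonneg _ _ hp0.le]
    rw [lintegral_const_mul _ (hAb.pow_const _)]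
    gcongr
    calc (w b)⁻¹ ^ p * ∫⁻ a, A a b ^ p ∂μ ≤ (w b)⁻¹ ^ p * (w b ^ p * K) := by gcongr
      _ = K := by
        rw [← mul_assoc, ← ENNReal.mul_rpow_of_nonneg _ _ hp0.le, ENNReal.inv_mul_cancel hb.1 hb.2,
          ENNReal.one_rpow, one_mul]
  calc ∫⁻ a, (∫⁻ b, A a b ∂κ) ^ p ∂μ
      ≤ ∫⁻ a, (∫⁻ b, w b ∂κ) ^ (p - 1) * ∫⁻ b, w b * ((w b)⁻¹ * A a b) ^ p ∂κ ∂μ :=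
        lintegral_mono hpt
    _ = (∫⁻ b, w b ∂κ) ^ (p - 1) * ∫⁻ b, ∫⁻ a, w b * ((w b)⁻¹ * A a b) ^ p ∂μ ∂κ := by
        rw [lintegral_const_mul _ hF.lintegral_prod_right', lintegral_lintegral_swap hF.aemeasurable]
    _ ≤ (∫⁻ b, w b ∂κ) ^ (p - 1) * ∫⁻ b, w b * K ∂κ :=
        mul_le_mul' le_rfl (lintegral_mono_ae hin)
    _ = (∫⁻ b, w b ∂κ) ^ (p - 1) * (∫⁻ b, w b ∂κ) ^ (1 : ℝ) * K := by
        rw [lintegral_mul_const _ hw, ENNReal.rpow_one, mul_assoc]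
    _ = _ := by
        rw [← ENNReal.rpow_add_of_nonneg _ _ (by linarith) zero_le_one, sub_add_cancel]

lemma enorm_sub_rpow_le (a b : ℝ) {p : ℝ} (hp : 1 ≤ p) :
    ‖a - b‖ₑ ^ p ≤ 2 ^ (p - 1) * (‖a‖ₑ ^ p + ‖b‖ₑ ^ p) :=
  (ENNReal.rpow_le_rpow (enorm_sub_le) (by linarith)).trans
    (ENNReal.rpow_add_le_mul_rpow_add_rpow _ _ hp)

lemma lintegral_enorm_sub_rpow_le (μ : Measure α) {f g : α → ℝ} (hf : Measurable f)
    (hg : Measurable g) {p : ℝ} (hp : 1 ≤ p) :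
    ∫⁻ x, ‖f x - g x‖ₑ ^ p ∂μ ≤
      2 ^ (p - 1) * (∫⁻ x, ‖f x‖ₑ ^ p ∂μ + ∫⁻ x, ‖g x‖ₑ ^ p ∂μ) := by
  have hf' := hf.enorm.pow_const p
  have hg' := hg.enorm.pow_const p
  calc ∫⁻ x, ‖f x - g x‖ₑ ^ p ∂μ ≤ ∫⁻ x, 2 ^ (p - 1) * (‖f x‖ₑ ^ p + ‖g x‖ₑ ^ p) ∂μ :=
        lintegral_mono fun x => enorm_sub_rpow_le _ _ hp
    _ = _ := by
        rw [lintegral_const_mul, lintegral_add_left hf']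
        exact hf'.add hg'

lemma lintegral_rpow_le_mul_lintegral_sq (μ : Measure α) {p : ℝ} (hp : 2 ≤ p) {f : α → ℝ≥0∞}
    (hf : Measurable f) {K : ℝ≥0∞} (hK : ∀ᵐ a ∂μ, f a ≤ K) :
    ∫⁻ a, f a ^ p ∂μ ≤ K ^ (p - 2) * ∫⁻ a, f a ^ (2 : ℝ) ∂μ := by
  rw [← lintegral_const_mul _ (hf.pow_const 2)]
  refine lintegral_mono_ae (hK.mono fun a ha => ?_)
  calc f a ^ p = f a ^ (p - 2) * f a ^ (2 : ℝ) := by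
        rw [← ENNReal.rpow_add_of_nonneg _ _ (by linarith) (by norm_num)]; congr 1; ring
    _ ≤ _ := by gcongr

/-- A sequence that is bounded in `L²` and in `L^∞`, converges to zero pointwise and is uniformly
small near infinity converges to zero in `L^p` for every `p > 2`. -/
lemma tendsto_lintegral_rpow_of_small_at_infinity {E : Type*} [NormedAddCommGroup E]
    [ProperSpace E] [MeasurableSpace E] [BorelSpace E] (μ : Measure E)
    [IsFiniteMeasureOnCompacts μ] {p : ℝ} (hp : 2 < p) {d : ℕ → E → ℝ≥0∞}
    (hd : ∀ n, Measurable (d n)) {K C : ℝ≥0∞} (hK : K ≠ ∞) (hC : C ≠ ∞)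
    (hdK : ∀ n x, d n x ≤ K) (hdC : ∀ n, ∫⁻ x, d n x ^ (2 : ℝ) ∂μ ≤ C)
    (hlim : ∀ x, Tendsto (fun n => d n x) atTop (𝓝 0))
    (hinf : ∀ ε : ℝ≥0∞, 0 < ε → ∃ R : ℝ, ∀ᶠ n in atTop, ∀ x, R ≤ ‖x‖ → d n x ≤ ε) :
    Tendsto (fun n => ∫⁻ x, d n x ^ p ∂μ) atTop (𝓝 0) := by
  rw [ENNReal.tendsto_nhds_zero]
  intro η hη
  have hη2 : 0 < η / 2 := ENNReal.half_pos hη.ne'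
  have hcont : Tendsto (fun ε : ℝ≥0∞ => ε ^ (p - 2) * C) (𝓝 0) (𝓝 0) := by
    have h1 : Tendsto (fun ε : ℝ≥0∞ => ε ^ (p - 2)) (𝓝 0) (𝓝 0) := by
      have := (ENNReal.continuous_rpow_const (y := p - 2)).tendsto 0
      rwa [ENNReal.zero_rpow_of_pos (by linarith)] at this
    simpa using ENNReal.Tendsto.mul_const h1 (Or.inr hC)
  obtain ⟨ε, hεη, hε⟩ : ∃ ε : ℝ≥0∞, ε ^ (p - 2) * C ≤ η / 2 ∧ 0 < ε := by
    have h1 := (hcont.eventually (Iic_mem_nhds hη2)).filter_mono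
      (nhdsWithin_le_nhds (s := Set.Ioi 0))
    obtain ⟨ε, h⟩ := (h1.and self_mem_nhdsWithin).exists
    exact ⟨ε, h⟩
  obtain ⟨R, hR⟩ := hinf ε hε
  have hball : Tendsto (fun n => ∫⁻ x in Metric.ball 0 R, d n x ^ p ∂μ) atTop (𝓝 0) := by
    have := tendsto_lintegral_of_dominated_convergence (μ := μ.restrict (Metric.ball 0 R))
      (F := fun n x => d n x ^ p) (f := fun _ => 0) (fun _ => K ^ p)
      (fun n => (hd n).pow_const p)
      (fun n => Eventually.of_forall fun x => ENNReal.rpow_le_rpow (hdK n x) (by linarith))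
      (by
        rw [lintegral_const, Measure.restrict_apply_univ]
        exact ENNReal.mul_ne_top (ENNReal.rpow_ne_top_of_nonneg (by linarith) hK)
          measure_ball_lt_top.ne)
      (Eventually.of_forall fun x => by
        have := ((ENNReal.continuous_rpow_const (y := p)).tendsto 0).comp (hlim x)
        rwa [ENNReal.zero_rpow_of_pos (by linarith)] at this)
    simpa using this
  filter_upwards [hR, hball.eventually (Iic_mem_nhds hη2)] with n hn hn'
  rw [← lintegral_add_compl _ (measurableSet_ball (x := (0 : E)) (ε := R)), ← ENNReal.add_halves η]
  refine add_le_add hn' (le_trans ?_ hεη)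
  refine (lintegral_rpow_le_mul_lintegral_sq _ hp.le (hd n) (K := ε) ?_).trans ?_
  · refine (ae_restrict_mem measurableSet_ball.compl).mono fun x hx => hn x ?_
    simpa using hx
  · gcongr
    exact (setLIntegral_le_lintegral _ _).trans (hdC n)

/-- Continuity of `u ↦ ∫ F(u)` along sequences converging in `L^p` and in `L^q`, when `F` is
continuous and dominated by `|·|^p + |·|^q`. -/
lemma tendsto_integral_comp_of_tendsto_lintegral_rpow (μ : Measure α) {u : ℕ → α → ℝ} {u₀ : α → ℝ}
    (hu : ∀ n, Measurable (u n)) (hu₀ : Measurable u₀) {F : ℝ → ℝ} (hF : Continuous F)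
    {m : ℝ≥0∞} (hm : m ≠ ∞) {p q : ℝ} (hp : 1 ≤ p) (hq : 1 ≤ q)
    (hFb : ∀ s, ‖F s‖ₑ ≤ m * (‖s‖ₑ ^ p + ‖s‖ₑ ^ q))
    (hFu : ∀ n, Integrable (fun x => F (u n x)) μ)
    (hup : Tendsto (fun n => ∫⁻ x, ‖u n x - u₀ x‖ₑ ^ p ∂μ) atTop (𝓝 0))
    (huq : Tendsto (fun n => ∫⁻ x, ‖u n x - u₀ x‖ₑ ^ q ∂μ) atTop (𝓝 0))
    (hu₀p : ∫⁻ x, ‖u₀ x‖ₑ ^ p ∂μ ≠ ∞) (hu₀q : ∫⁻ x, ‖u₀ x‖ₑ ^ q ∂μ ≠ ∞) :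
    Tendsto (fun n => ∫ x, F (u n x) ∂μ) atTop (𝓝 (∫ x, F (u₀ x) ∂μ)) := by
  have hFu₀m : Measurable fun x => F (u₀ x) := hF.measurable.comp hu₀
  refine tendsto_integral_of_L1 _ hFu₀m.aestronglyMeasurable (Eventually.of_forall hFu) ?_
  have hκ : ∀ r : ℝ, 1 ≤ r → (2 : ℝ≥0∞) ^ (r - 1) ≠ ∞ := fun r hr =>
    ENNReal.rpow_ne_top_of_nonneg (by linarith) (by simp)
  set κp : ℝ≥0∞ := 2 ^ (p - 1)
  set κq : ℝ≥0∞ := 2 ^ (q - 1)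
  have hκp : κp ≠ ∞ := hκ p hp
  have hκq : κq ≠ ∞ := hκ q hq
  let X : ℕ → α → ℝ≥0∞ := fun n x => ‖F (u n x) - F (u₀ x)‖ₑ
  let a : ℕ → α → ℝ≥0∞ := fun n x =>
    m * (κp * ‖u n x - u₀ x‖ₑ ^ p + κq * ‖u n x - u₀ x‖ₑ ^ q)
  let b : α → ℝ≥0∞ := fun x => m * ((κp + 1) * ‖u₀ x‖ₑ ^ p + (κq + 1) * ‖u₀ x‖ₑ ^ q)
  have hXm : ∀ n, Measurable (X n) := fun n => ((hF.measurable.comp (hu n)).sub hFu₀m).enorm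
  have hdm : ∀ n (r : ℝ), Measurable fun x => ‖u n x - u₀ x‖ₑ ^ r := fun n r =>
    ((hu n).sub hu₀).enorm.pow_const r
  have ham : ∀ n, Measurable (a n) := fun n =>
    (((hdm n p).const_mul _).add ((hdm n q).const_mul _)).const_mul _
  have hbound : ∀ n x, X n x - a n x ≤ b x := fun n x => by
    rw [tsub_le_iff_left]
    have key : ∀ r : ℝ, 1 ≤ r → ‖u n x‖ₑ ^ r ≤
        2 ^ (r - 1) * (‖u n x - u₀ x‖ₑ ^ r + ‖u₀ x‖ₑ ^ r) := fun r hr => by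
      have := enorm_sub_rpow_le (u n x - u₀ x) (-u₀ x) hr
      simpa using this
    calc X n x ≤ ‖F (u n x)‖ₑ + ‖F (u₀ x)‖ₑ := enorm_sub_le
      _ ≤ m * (κp * (‖u n x - u₀ x‖ₑ ^ p + ‖u₀ x‖ₑ ^ p) +
            κq * (‖u n x - u₀ x‖ₑ ^ q + ‖u₀ x‖ₑ ^ q)) + m * (‖u₀ x‖ₑ ^ p + ‖u₀ x‖ₑ ^ q) := by
          refine add_le_add ((hFb _).trans ?_) (hFb _)
          gcongr
          · exact key p hp
          · exact key q hq
      _ = a n x + b x := by simp only [a, b]; ring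
  have hb : ∫⁻ x, b x ∂μ ≠ ∞ := by
    have h1 : ∀ r : ℝ, Measurable fun x => ‖u₀ x‖ₑ ^ r := fun r => hu₀.enorm.pow_const r
    have hsum : ∫⁻ x, b x ∂μ =
        m * ((κp + 1) * ∫⁻ x, ‖u₀ x‖ₑ ^ p ∂μ + (κq + 1) * ∫⁻ x, ‖u₀ x‖ₑ ^ q ∂μ) := by
      simp only [b]
      rw [lintegral_const_mul, lintegral_add_left ((h1 p).const_mul _),
        lintegral_const_mul _ (h1 p), lintegral_const_mul _ (h1 q)]
      exact ((h1 p).const_mul _).add ((h1 q).const_mul _)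
    rw [hsum]
    exact ENNReal.mul_ne_top hm (ENNReal.add_ne_top.2
      ⟨ENNReal.mul_ne_top (ENNReal.add_ne_top.2 ⟨hκp, ENNReal.one_ne_top⟩) hu₀p,
        ENNReal.mul_ne_top (ENNReal.add_ne_top.2 ⟨hκq, ENNReal.one_ne_top⟩) hu₀q⟩)
  have ha : Tendsto (fun n => ∫⁻ x, a n x ∂μ) atTop (𝓝 0) := by
    have h1 : ∀ n, ∫⁻ x, a n x ∂μ = m * (κp * ∫⁻ x, ‖u n x - u₀ x‖ₑ ^ p ∂μ +
        κq * ∫⁻ x, ‖u n x - u₀ x‖ₑ ^ q ∂μ) := fun n => by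
      simp only [a]
      rw [lintegral_const_mul, lintegral_add_left ((hdm n p).const_mul _),
        lintegral_const_mul _ (hdm n p), lintegral_const_mul _ (hdm n q)]
      exact ((hdm n p).const_mul _).add ((hdm n q).const_mul _)
    simp_rw [h1]
    have h2 := ENNReal.Tendsto.const_mul ((ENNReal.Tendsto.const_mul hup (Or.inr hκp)).add
      (ENNReal.Tendsto.const_mul huq (Or.inr hκq))) (Or.inr hm)
    simpa using h2
  have hmeasure : TendstoInMeasure μ u atTop u₀ := by
    have hp0 : 0 < p := by linarith
    refine tendstoInMeasure_of_tendsto_eLpNorm (p := ENNReal.ofReal p) (by simpa using hp0)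
      (fun n => (hu n).aestronglyMeasurable) hu₀.aestronglyMeasurable ?_
    have h1 : ∀ n, eLpNorm (u n - u₀) (ENNReal.ofReal p) μ =
        (∫⁻ x, ‖u n x - u₀ x‖ₑ ^ p ∂μ) ^ (1 / p) := fun n => by
      rw [eLpNorm_eq_lintegral_rpow_enorm_toReal (by simpa using hp0) ENNReal.ofReal_ne_top,
        ENNReal.toReal_ofReal hp0.le]
      rfl
    simp_rw [h1]
    have h2 := ((ENNReal.continuous_rpow_const (y := 1 / p)).tendsto 0).comp hup
    rwa [ENNReal.zero_rpow_of_pos (by positivity)] at h2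
  refine tendsto_of_subseq_tendsto fun ns hns => ?_
  obtain ⟨ms, hms, hae⟩ := TendstoInMeasure.exists_seq_tendsto_ae
    (f := fun n => u (ns n)) (fun ε hε => (hmeasure ε hε).comp hns)
  refine ⟨ms, ?_⟩
  have hns' : Tendsto (fun n => ns (ms n)) atTop atTop := hns.comp hms.tendsto_atTop
  have hdiff : Tendsto (fun n => ∫⁻ x, X (ns (ms n)) x - a (ns (ms n)) x ∂μ) atTop (𝓝 0) := by
    have := tendsto_lintegral_of_dominated_convergence (μ := μ)
      (F := fun n x => X (ns (ms n)) x - a (ns (ms n)) x) (f := fun _ => 0) b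
      (fun n => (hXm _).sub (ham _)) (fun n => Eventually.of_forall fun x => hbound _ x) hb
      (hae.mono fun x hx => by
        have hX : Tendsto (fun n => X (ns (ms n)) x) atTop (𝓝 0) := by
          have := (((hF.tendsto _).comp hx).sub_const (F (u₀ x))).enorm
          simpa using this
        exact tendsto_of_tendsto_of_tendsto_of_le_of_le tendsto_const_nhds hX
          (fun _ => zero_le) (fun _ => tsub_le_self))
    simpa using this
  have hsum := hdiff.add (ha.comp hns')
  rw [add_zero] at hsum
  refine tendsto_of_tendsto_of_tendsto_of_le_of_le tendsto_const_nhds hsum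
    (fun _ => zero_le) (fun n => ?_)
  simp only [Function.comp_apply]
  rw [← lintegral_add_right _ (ham _)]
  exact lintegral_mono fun x => le_tsub_add

end LebesgueIntegral

section Averaging

variable {E : Type*} [NormedAddCommGroup E] [NormedSpace ℝ E]

/-- The average of `f` with respect to `ν`, at scale `h`. -/
def scaledAverage [MeasurableSpace E] (ν : Measure E) (h : ℝ) (f : E → ℝ) (x : E) : ℝ :=
  ∫ z, f (x - h • z) ∂ν

lemma enorm_sub_le_lintegral_fderiv {f : E → ℝ} (hf : Differentiable ℝ f) [MeasurableSpace E]
    [BorelSpace E] (x : E) {z : E} (hz : ‖z‖ ≤ 1) {h : ℝ} (hh : 0 ≤ h) :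
    ‖f x - f (x - h • z)‖ₑ ≤ ∫⁻ s in Set.Ioc 0 h, ‖fderiv ℝ f (x - s • z)‖ₑ := by
  set I := ∫⁻ s in Set.Ioc 0 h, ‖fderiv ℝ f (x - s • z)‖ₑ with hI
  by_cases hfin : I = ∞
  · rw [hfin]; exact le_top
  have hpt : ∀ s : ℝ, ‖fderiv ℝ f (x - s • z) (-z)‖ₑ ≤ ‖fderiv ℝ f (x - s • z)‖ₑ := fun s => by
    rw [← ofReal_norm, ← ofReal_norm]
    refine ENNReal.ofReal_le_ofReal ((ContinuousLinearMap.le_opNorm _ _).trans ?_)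
    rw [norm_neg]
    exact mul_le_of_le_one_right (norm_nonneg _) hz
  have hd : ∀ s : ℝ, HasDerivAt (fun s : ℝ => f (x - s • z)) (fderiv ℝ f (x - s • z) (-z)) s := by
    intro s
    refine (hf _).hasFDerivAt.comp_hasDerivAt s ?_
    simpa using ((hasDerivAt_id s).smul_const z).const_sub x
  have hint : IntervalIntegrable (fun s : ℝ => fderiv ℝ f (x - s • z) (-z)) volume 0 h := by
    rw [intervalIntegrable_iff_integrableOn_Ioc_of_le hh]
    refine ⟨?_, ?_⟩
    · have : (fun s : ℝ => fderiv ℝ f (x - s • z) (-z)) = deriv (fun s : ℝ => f (x - s • z)) :=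
        funext fun s => ((hd s).deriv).symm
      rw [this]
      exact (measurable_deriv _).aestronglyMeasurable
    · exact (lintegral_mono hpt).trans_lt (lt_top_iff_ne_top.2 hfin)
  have key := intervalIntegral.integral_eq_sub_of_hasDerivAt (fun s _ => hd s) hint
  simp only [zero_smul, sub_zero] at key
  rw [← enorm_neg, neg_sub, ← key, intervalIntegral.integral_of_le hh]
  exact (enorm_integral_le_lintegral_enorm _).trans (lintegral_mono hpt)

variable [FiniteDimensional ℝ E] [MeasurableSpace E] [BorelSpace E]
  (μ : Measure E) [μ.IsAddHaarMeasure] {ν : Measure E} {C : ℝ≥0∞}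

lemma lintegral_comp_sub_smul_le (hν : ν ≤ C • μ) {f : E → ℝ≥0∞} (hf : Measurable f) (x : E)
    {s : ℝ} (hs : 0 < s) :
    ∫⁻ z, f (x - s • z) ∂ν ≤ C * ENNReal.ofReal ((s ^ Module.finrank ℝ E)⁻¹) * ∫⁻ y, f y ∂μ := by
  have hm : Measurable fun z : E => s • z := measurable_const_smul s
  have hf' : Measurable fun y => f (x - y) := hf.comp (measurable_const.sub measurable_id)
  calc ∫⁻ z, f (x - s • z) ∂ν ≤ ∫⁻ z, f (x - s • z) ∂(C • μ) := lintegral_mono' hν le_rfl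
    _ = C * ∫⁻ y, f (x - y) ∂(Measure.map (fun z : E => s • z) μ) := by
        rw [lintegral_smul_measure, lintegral_map hf' hm, smul_eq_mul]
    _ = _ := by
        rw [Measure.map_addHaar_smul μ hs.ne', lintegral_smul_measure, lintegral_sub_left_eq_self,
          abs_of_nonneg (by positivity), smul_eq_mul, mul_assoc]

variable [IsProbabilityMeasure ν]

lemma lintegral_lintegral_comp_sub_smul {f : E → ℝ≥0∞} (hf : Measurable f) (s : ℝ) :
    ∫⁻ x, ∫⁻ z, f (x - s • z) ∂ν ∂μ = ∫⁻ y, f y ∂μ := by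
  rw [lintegral_lintegral_swap]
  · simp_rw [lintegral_sub_right_eq_self f]
    simp
  · exact (hf.comp (by fun_prop : Measurable fun t : E × E => t.1 - s • t.2)).aemeasurable

lemma measurable_lintegral_comp_sub_smul {f : E → ℝ≥0∞} (hf : Measurable f) (s : ℝ) :
    Measurable fun x => ∫⁻ z, f (x - s • z) ∂ν :=
  Measurable.lintegral_prod_right' (f := fun t : E × E => f (t.1 - s • t.2))
    (hf.comp (by fun_prop))

omit [FiniteDimensional ℝ E] [IsProbabilityMeasure ν] in
lemma integrable_comp_sub_smul [ProperSpace E] [IsFiniteMeasure ν] (hν1 : ∀ᵐ z ∂ν, ‖z‖ < 1)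
    {f : E → ℝ} (hf : Continuous f) (x : E) (h : ℝ) :
    Integrable (fun z => f (x - h • z)) ν := by
  have hc : Continuous fun z => f (x - h • z) := by fun_prop
  obtain ⟨K, hK⟩ := (isCompact_closedBall (0 : E) 1).exists_bound_of_continuousOn hc.continuousOn
  exact Integrable.of_bound hc.aestronglyMeasurable K
    (hν1.mono fun z hz => hK z (by simpa using hz.le))

lemma measurable_scaledAverage {f : E → ℝ} (hf : Continuous f) (h : ℝ) :
    Measurable (scaledAverage ν h f) := by
  have : StronglyMeasurable fun t : E × E => f (t.1 - h • t.2) :=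
    Continuous.stronglyMeasurable (by fun_prop)
  exact this.integral_prod_right.measurable

lemma enorm_sub_scaledAverage_le (hν1 : ∀ᵐ z ∂ν, ‖z‖ < 1) {f : E → ℝ} (hf : Differentiable ℝ f)
    (x : E) {h : ℝ} (hh : 0 ≤ h) :
    ‖f x - scaledAverage ν h f x‖ₑ ≤
      ∫⁻ s in Set.Ioc 0 h, ∫⁻ z, ‖fderiv ℝ f (x - s • z)‖ₑ ∂ν := by
  have hint := integrable_comp_sub_smul hν1 hf.continuous x h
  have heq : f x - scaledAverage ν h f x = ∫ z, (f x - f (x - h • z)) ∂ν := by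
    rw [integral_sub (integrable_const _) hint]
    simp [scaledAverage]
  rw [heq, lintegral_lintegral_swap]
  · refine (enorm_integral_le_lintegral_enorm _).trans (lintegral_mono_ae ?_)
    exact hν1.mono fun z hz => enorm_sub_le_lintegral_fderiv hf x hz.le hh
  · exact ((measurable_fderiv ℝ f).enorm.comp
      (by fun_prop : Measurable fun t : ℝ × E => x - t.1 • t.2)).aemeasurable

/-- Averages of an `L²` function at scale `s` lie in `L^p`, with an explicit bound. -/
lemma lintegral_rpow_average_le (hν : ν ≤ C • μ) {g : E → ℝ≥0∞} (hg : Measurable g) {p : ℝ}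
    (hp : 2 < p) {s : ℝ} (hs : 0 < s) :
    ∫⁻ x, (∫⁻ z, g (x - s • z) ∂ν) ^ p ∂μ ≤
      (C * ENNReal.ofReal ((s ^ Module.finrank ℝ E)⁻¹) * ∫⁻ y, g y ^ (2 : ℝ) ∂μ) ^ ((p - 2) / 2) *
        ∫⁻ y, g y ^ (2 : ℝ) ∂μ := by
  have hj : ∀ x, (∫⁻ z, g (x - s • z) ∂ν) ^ (2 : ℝ) ≤ ∫⁻ z, g (x - s • z) ^ (2 : ℝ) ∂ν := fun x =>
    lintegral_rpow_le ν one_lt_two (hg.comp (by fun_prop))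
  have hg2 := hg.pow_const (2 : ℝ)
  refine (lintegral_rpow_le_mul_lintegral_sq μ hp.le (measurable_lintegral_comp_sub_smul hg s)
    (K := (C * ENNReal.ofReal ((s ^ Module.finrank ℝ E)⁻¹) *
      ∫⁻ y, g y ^ (2 : ℝ) ∂μ) ^ (1 / 2 : ℝ)) (Eventually.of_forall fun x => ?_)).trans ?_
  · rw [one_div, ENNReal.le_rpow_inv_iff two_pos]
    exact (hj x).trans (lintegral_comp_sub_smul_le μ hν hg2 x hs)
  · rw [← ENNReal.rpow_mul, one_div_mul_eq_div]
    refine mul_le_mul' le_rfl ?_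
    calc _ ≤ ∫⁻ x, ∫⁻ z, g (x - s • z) ^ (2 : ℝ) ∂ν ∂μ := lintegral_mono hj
      _ = _ := lintegral_lintegral_comp_sub_smul μ hg2 s

/-- Poincaré–Sobolev estimate: the `L^p` distance between a function and its average at scale `h`
is controlled by the `L²` norm of its gradient. -/
lemma lintegral_rpow_sub_scaledAverage_le (hν : ν ≤ C • μ) (hν1 : ∀ᵐ z ∂ν, ‖z‖ < 1) {f : E → ℝ}
    (hf : Differentiable ℝ f) {p : ℝ} (hp : 2 < p) {h : ℝ} (hh : 0 ≤ h) :
    ∫⁻ x, ‖f x - scaledAverage ν h f x‖ₑ ^ p ∂μ ≤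
      (∫⁻ s in Set.Ioc 0 h,
        ENNReal.ofReal (s ^ (-(Module.finrank ℝ E * (p - 2) / (2 * p)) : ℝ))) ^ p *
      (C ^ ((p - 2) / 2) * (∫⁻ y, ‖fderiv ℝ f y‖ₑ ^ (2 : ℝ) ∂μ) ^ (p / 2)) := by
  have hp0 : 0 < p := by linarith
  have hq : 0 ≤ (p - 2) / 2 := by linarith
  have hg : Measurable fun y => ‖fderiv ℝ f y‖ₑ := (measurable_fderiv ℝ f).enorm
  have hA : Measurable fun t : E × ℝ => ∫⁻ z, ‖fderiv ℝ f (t.1 - t.2 • z)‖ₑ ∂ν :=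
    Measurable.lintegral_prod_right'
      (f := fun t : (E × ℝ) × E => ‖fderiv ℝ f (t.1.1 - t.1.2 • t.2)‖ₑ) (hg.comp (by fun_prop))
  refine (lintegral_mono fun x => ENNReal.rpow_le_rpow
    (enorm_sub_scaledAverage_le hν1 hf x hh) hp0.le).trans ?_
  refine lintegral_rpow_lintegral_le μ (volume.restrict (Set.Ioc 0 h)) (by linarith) hA
    (by fun_prop) ?_ ?_
  · refine (ae_restrict_mem measurableSet_Ioc).mono fun s hs => ⟨?_, ENNReal.ofReal_ne_top⟩
    exact (ENNReal.ofReal_pos.2 (Real.rpow_pos_of_pos hs.1 _)).ne'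
  · refine (ae_restrict_mem measurableSet_Ioc).mono fun s hs => ?_
    refine (lintegral_rpow_average_le μ hν hg hp hs.1).trans_eq ?_
    have hscale : ENNReal.ofReal ((s ^ Module.finrank ℝ E)⁻¹) ^ ((p - 2) / 2) =
        ENNReal.ofReal (s ^ (-(Module.finrank ℝ E * (p - 2) / (2 * p)) : ℝ)) ^ p := by
      have hs0 : 0 < s := hs.1
      rw [ENNReal.ofReal_rpow_of_nonneg (by positivity) hp0.le,
        ENNReal.ofReal_rpow_of_nonneg (by positivity) hq, ← Real.rpow_natCast,
        ← Real.rpow_neg hs0.le, ← Real.rpow_mul hs0.le, ← Real.rpow_mul hs0.le]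
      congr 2
      field_simp
    rw [← hscale, ENNReal.mul_rpow_of_nonneg _ _ hq, ENNReal.mul_rpow_of_nonneg _ _ hq,
      show p / 2 = (p - 2) / 2 + 1 by ring, ENNReal.rpow_add_of_nonneg _ _ hq zero_le_one,
      ENNReal.rpow_one]
    ring

omit [FiniteDimensional ℝ E] in
lemma enorm_scaledAverage_sq_le [SecondCountableTopology E] {f : E → ℝ} (hf : Continuous f)
    (x : E) (h : ℝ) :
    ‖scaledAverage ν h f x‖ₑ ^ (2 : ℝ) ≤ ∫⁻ z, ‖f (x - h • z)‖ₑ ^ (2 : ℝ) ∂ν :=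
  (ENNReal.rpow_le_rpow (enorm_integral_le_lintegral_enorm _) zero_le_two).trans
    (lintegral_rpow_le ν one_lt_two (hf.measurable.enorm.comp (by fun_prop)))

lemma lintegral_sq_scaledAverage_le {f : E → ℝ} (hf : Continuous f) (h : ℝ) :
    ∫⁻ x, ‖scaledAverage ν h f x‖ₑ ^ (2 : ℝ) ∂μ ≤ ∫⁻ x, ‖f x‖ₑ ^ (2 : ℝ) ∂μ :=
  (lintegral_mono fun x => enorm_scaledAverage_sq_le hf x h).trans_eq
    (lintegral_lintegral_comp_sub_smul μ (hf.measurable.enorm.pow_const (2 : ℝ)) h)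

lemma enorm_scaledAverage_sq_le_ball (hν : ν ≤ C • μ) (hν1 : ∀ᵐ z ∂ν, ‖z‖ < 1) {f : E → ℝ}
    (hf : Continuous f) (x : E) {h : ℝ} (hh : 0 < h) (hh1 : h ≤ 1) :
    ‖scaledAverage ν h f x‖ₑ ^ (2 : ℝ) ≤ C * ENNReal.ofReal ((h ^ Module.finrank ℝ E)⁻¹) *
      ∫⁻ y in Metric.ball x 1, ‖f y‖ₑ ^ (2 : ℝ) ∂μ := by
  have hf2 : Measurable fun y => ‖f y‖ₑ ^ (2 : ℝ) := hf.measurable.enorm.pow_const _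
  rw [← lintegral_indicator measurableSet_ball]
  refine ((enorm_scaledAverage_sq_le hf x h).trans_eq ?_).trans
    (lintegral_comp_sub_smul_le μ hν (hf2.indicator (measurableSet_ball (x := x) (ε := 1))) x hh)
  refine lintegral_congr_ae (hν1.mono fun z hz => ?_)
  have : x - h • z ∈ Metric.ball x 1 := by
    rw [Metric.mem_ball, dist_eq_norm, sub_sub_cancel_left, norm_neg, norm_smul, Real.norm_eq_abs,
      abs_of_pos hh]
    calc h * ‖z‖ ≤ 1 * ‖z‖ := by gcongr
      _ < 1 := by simpa using hz
  simp [Set.indicator_of_mem this]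

lemma tendsto_setLIntegral_Ioc_rpow {b : ℝ} (hb : b < 1) :
    Tendsto (fun h : ℝ => ∫⁻ s in Set.Ioc 0 h, ENNReal.ofReal (s ^ (-b))) (𝓝[>] 0) (𝓝 0) := by
  have heq : ∀ h ∈ Set.Ioi (0 : ℝ), ENNReal.ofReal (h ^ (-b + 1) / (-b + 1)) =
      ∫⁻ s in Set.Ioc 0 h, ENNReal.ofReal (s ^ (-b)) := fun h hh => by
    have hi : IntervalIntegrable (fun s : ℝ => s ^ (-b)) volume 0 h :=
      intervalIntegral.intervalIntegrable_rpow' (by linarith)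
    rw [intervalIntegrable_iff_integrableOn_Ioc_of_le (le_of_lt hh)] at hi
    rw [← ofReal_integral_eq_lintegral_ofReal hi, ← intervalIntegral.integral_of_le (le_of_lt hh),
      integral_rpow (Or.inl (by linarith)), Real.zero_rpow (by linarith), sub_zero]
    exact (ae_restrict_mem measurableSet_Ioc).mono fun s hs => Real.rpow_nonneg hs.1.le _
  refine Tendsto.congr' (eventually_nhdsWithin_of_forall heq) ?_
  have hc : Continuous fun h : ℝ => ENNReal.ofReal (h ^ (-b + 1) / (-b + 1)) :=
    ENNReal.continuous_ofReal.comp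
      ((Real.continuous_rpow_const (by linarith)).div_const _)
  have := hc.tendsto 0
  rw [Real.zero_rpow (by linarith), zero_div, ENNReal.ofReal_zero] at this
  exact this.mono_left nhdsWithin_le_nhds

omit [IsProbabilityMeasure ν] in
/-- A mollifier: a probability measure on the unit ball with bounded density, whose scaled averages
are pairings with smooth compactly supported functions. -/
lemma exists_mollifier : ∃ (ν : Measure E) (C : ℝ≥0∞), IsProbabilityMeasure ν ∧ C ≠ ∞ ∧
    ν ≤ C • μ ∧ (∀ᵐ z ∂ν, ‖z‖ < 1) ∧ ∀ (h : ℝ), 0 < h → ∀ x : E, ∃ φ : E → ℝ,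
      ContDiff ℝ (⊤ : ℕ∞) φ ∧ HasCompactSupport φ ∧
      ∀ f : E → ℝ, ∫ y, f y * φ y ∂μ = scaledAverage ν h f x := by
  let b : ContDiffBump (0 : E) := ⟨1 / 2, 1, by norm_num, by norm_num⟩
  let ρ : E → ℝ := b.normed μ
  have hρm : Measurable fun z => (ρ z).toNNReal := b.continuous_normed.measurable.real_toNNReal
  have hρ0 : ∀ z, 0 ≤ ρ z := b.nonneg_normed
  obtain ⟨L, hL⟩ : ∃ L : ℝ, ∀ z, ρ z ≤ L :=
    ⟨_, b.normed_le_div_measure_closedBall_rOut μ 2 (by norm_num [b])⟩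
  refine ⟨μ.withDensity fun z => ((ρ z).toNNReal : ℝ≥0∞), ENNReal.ofReal L, ⟨?_⟩,
    ENNReal.ofReal_ne_top, ?_, ?_, ?_⟩
  · rw [withDensity_apply _ MeasurableSet.univ, Measure.restrict_univ]
    change ∫⁻ z, ENNReal.ofReal (ρ z) ∂μ = 1
    rw [← ofReal_integral_eq_lintegral_ofReal b.integrable_normed
      (Eventually.of_forall hρ0), b.integral_normed, ENNReal.ofReal_one]
  · rw [← withDensity_const]
    exact withDensity_mono (Eventually.of_forall fun z => ENNReal.ofReal_le_ofReal (hL z))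
  · rw [ae_withDensity_iff hρm.coe_nnreal_ennreal]
    refine Eventually.of_forall fun z hz => ?_
    have hz' : z ∈ Function.support ρ := fun h0 => hz (by simp [h0])
    have hs : Function.support ρ = Metric.ball 0 1 := b.support_normed_eq
    rw [hs] at hz'
    simpa using hz'
  · intro h hh x
    refine ⟨fun y => |(h⁻¹ ^ Module.finrank ℝ E)| * ρ (h⁻¹ • (x - y)), ?_, ?_, ?_⟩
    · refine contDiff_const.mul (b.contDiff_normed.comp ?_)
      exact contDiff_const.smul (contDiff_const.sub contDiff_id)
    · refine HasCompactSupport.mul_left ?_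
      let e : E ≃ₜ E := (Homeomorph.subLeft x).trans (Homeomorph.smulOfNeZero h⁻¹ (inv_ne_zero hh.ne'))
      exact b.hasCompactSupport_normed.comp_homeomorph e
    · intro f
      rw [scaledAverage, integral_withDensity_eq_integral_smul hρm]
      have h1 : ∀ z, (ρ z).toNNReal • f (x - h • z) = ρ (h⁻¹ • (h • z)) * f (x - h • z) := by
        intro z
        rw [NNReal.smul_def, Real.coe_toNNReal _ (hρ0 z), smul_eq_mul, inv_smul_smul₀ hh.ne']
      simp_rw [h1]
      rw [Measure.integral_comp_smul μ (fun y => ρ (h⁻¹ • y) * f (x - y)) h,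
        ← integral_sub_left_eq_self _ μ x, smul_eq_mul, ← integral_const_mul]
      congr 1
      ext y
      simp only [sub_sub_cancel, inv_pow]
      ring

end Averaging

section Compactness

variable {E : Type*} [NormedAddCommGroup E] [NormedSpace ℝ E] [FiniteDimensional ℝ E]
  [MeasurableSpace E] [BorelSpace E] (μ : Measure E) [μ.IsAddHaarMeasure] {ν : Measure E}
  [IsProbabilityMeasure ν] {C B : ℝ≥0∞}

lemma enorm_scaledAverage_le (hν : ν ≤ C • μ) (hν1 : ∀ᵐ z ∂ν, ‖z‖ < 1) {f : E → ℝ}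
    (hf : Continuous f) (x : E) {h : ℝ} (hh : 0 < h) (hh1 : h ≤ 1)
    (hB : ∫⁻ x, ‖f x‖ₑ ^ (2 : ℝ) ∂μ ≤ B) :
    ‖scaledAverage ν h f x‖ₑ ≤
      (C * ENNReal.ofReal ((h ^ Module.finrank ℝ E)⁻¹) * B) ^ (2 : ℝ)⁻¹ := by
  rw [ENNReal.le_rpow_inv_iff two_pos]
  refine (enorm_scaledAverage_sq_le_ball μ hν hν1 hf x hh hh1).trans ?_
  gcongr
  exact (setLIntegral_le_lintegral _ _).trans hB

lemma tendsto_lintegral_rpow_scaledAverage_sub (hC : C ≠ ∞) (hν : ν ≤ C • μ)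
    (hν1 : ∀ᵐ z ∂ν, ‖z‖ < 1) {u : ℕ → E → ℝ} {u₀ : E → ℝ} (hu : ∀ n, Continuous (u n))
    (hu₀ : Continuous u₀) (hB : B ≠ ∞) (hu2 : ∀ n, ∫⁻ x, ‖u n x‖ₑ ^ (2 : ℝ) ∂μ ≤ B)
    (hu₀2 : ∫⁻ x, ‖u₀ x‖ₑ ^ (2 : ℝ) ∂μ ≤ B)
    (hvan : ∀ ε : ℝ≥0∞, 0 < ε → ∃ R : ℝ, ∀ᶠ n in atTop, ∀ x, R ≤ ‖x‖ →
      ∫⁻ y in Metric.ball x 1, ‖u n y‖ₑ ^ (2 : ℝ) ∂μ ≤ ε)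
    {h : ℝ} (hh : 0 < h) (hh1 : h ≤ 1)
    (hlim : ∀ x, Tendsto (fun n => scaledAverage ν h (u n) x) atTop
      (𝓝 (scaledAverage ν h u₀ x))) {p : ℝ} (hp : 2 < p) :
    Tendsto (fun n => ∫⁻ x, ‖scaledAverage ν h (u n) x - scaledAverage ν h u₀ x‖ₑ ^ p ∂μ) atTop
      (𝓝 0) := by
  set c := C * ENNReal.ofReal ((h ^ Module.finrank ℝ E)⁻¹) with hc
  have hc_top : c ≠ ∞ := ENNReal.mul_ne_top hC ENNReal.ofReal_ne_top
  have hm : ∀ n, Measurable (scaledAverage ν h (u n)) := fun n => measurable_scaledAverage (hu n) h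
  have hm₀ : Measurable (scaledAverage ν h u₀) := measurable_scaledAverage hu₀ h
  refine tendsto_lintegral_rpow_of_small_at_infinity μ hp
    (K := (c * B) ^ (2 : ℝ)⁻¹ + (c * B) ^ (2 : ℝ)⁻¹) (C := 2 ^ ((2 : ℝ) - 1) * (B + B))
    (fun n => ((hm n).sub hm₀).enorm) ?_ ?_ ?_ ?_ ?_ ?_
  · have := ENNReal.rpow_ne_top_of_nonneg (by norm_num : (0 : ℝ) ≤ 2⁻¹) (ENNReal.mul_ne_top hc_top hB)
    exact ENNReal.add_ne_top.2 ⟨this, this⟩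
  · exact ENNReal.mul_ne_top (ENNReal.rpow_ne_top_of_nonneg (by norm_num) (by simp))
      (ENNReal.add_ne_top.2 ⟨hB, hB⟩)
  · exact fun n x => enorm_sub_le.trans (add_le_add
      (enorm_scaledAverage_le μ hν hν1 (hu n) x hh hh1 (hu2 n))
      (enorm_scaledAverage_le μ hν hν1 hu₀ x hh hh1 hu₀2))
  · intro n
    refine (lintegral_enorm_sub_rpow_le μ (hm n) hm₀ one_le_two).trans ?_
    gcongr
    · exact (lintegral_sq_scaledAverage_le μ (hu n) h).trans (hu2 n)
    · exact (lintegral_sq_scaledAverage_le μ hu₀ h).trans hu₀2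
  · intro x
    have := ((hlim x).sub_const (scaledAverage ν h u₀ x)).enorm
    simpa using this
  · intro ε hε
    obtain ⟨R, hR⟩ := hvan ((ε / 2) ^ (2 : ℝ) / c) (ENNReal.div_pos
      (ENNReal.rpow_pos_of_nonneg (ENNReal.half_pos hε.ne') zero_le_two).ne' hc_top)
    have hsmall : ∀ᶠ n in atTop, ∀ x, R ≤ ‖x‖ → ‖scaledAverage ν h (u n) x‖ₑ ≤ ε / 2 := by
      filter_upwards [hR] with n hn x hx
      rw [← ENNReal.rpow_le_rpow_iff two_pos]
      refine (enorm_scaledAverage_sq_le_ball μ hν hν1 (hu n) x hh hh1).trans ?_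
      exact (mul_le_mul' le_rfl (hn x hx)).trans ENNReal.mul_div_le
    refine ⟨R, hsmall.mono fun n hn x hx => ?_⟩
    have h0 : ‖scaledAverage ν h u₀ x‖ₑ ≤ ε / 2 :=
      le_of_tendsto (hlim x).enorm (hsmall.mono fun m hm => hm x hx)
    exact (enorm_sub_le.trans (add_le_add (hn x hx) h0)).trans_eq (ENNReal.add_halves ε)

/-- A sequence bounded in `H¹`, converging weakly to `u₀`, whose `L²` mass on unit balls is
uniformly small near infinity converges strongly in `L^p` for subcritical `p > 2`. -/
theorem tendsto_lintegral_rpow_sub {u : ℕ → E → ℝ} {u₀ : E → ℝ}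
    (hu : ∀ n, Differentiable ℝ (u n)) (hu₀ : Differentiable ℝ u₀) (hB : B ≠ ∞)
    (hu2 : ∀ n, ∫⁻ x, ‖u n x‖ₑ ^ (2 : ℝ) ∂μ ≤ B)
    (hu₀2 : ∫⁻ x, ‖u₀ x‖ₑ ^ (2 : ℝ) ∂μ ≤ B)
    (hg : ∀ n, ∫⁻ x, ‖fderiv ℝ (u n) x‖ₑ ^ (2 : ℝ) ∂μ ≤ B)
    (hg₀ : ∫⁻ x, ‖fderiv ℝ u₀ x‖ₑ ^ (2 : ℝ) ∂μ ≤ B)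
    (hvan : ∀ ε : ℝ≥0∞, 0 < ε → ∃ R : ℝ, ∀ᶠ n in atTop, ∀ x, R ≤ ‖x‖ →
      ∫⁻ y in Metric.ball x 1, ‖u n y‖ₑ ^ (2 : ℝ) ∂μ ≤ ε)
    (hweak : ∀ φ : E → ℝ, ContDiff ℝ (⊤ : ℕ∞) φ → HasCompactSupport φ →
      Tendsto (fun n => ∫ x, u n x * φ x ∂μ) atTop (𝓝 (∫ x, u₀ x * φ x ∂μ)))
    {p : ℝ} (hp : 2 < p) (hp' : Module.finrank ℝ E * (p - 2) < 2 * p) :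
    Tendsto (fun n => ∫⁻ x, ‖u n x - u₀ x‖ₑ ^ p ∂μ) atTop (𝓝 0) ∧
      ∫⁻ x, ‖u₀ x‖ₑ ^ p ∂μ ≠ ∞ := by
  obtain ⟨ν, C, hνp, hC, hν, hν1, htest⟩ := exists_mollifier μ
  have hp0 : 0 < p := by linarith
  set b : ℝ := Module.finrank ℝ E * (p - 2) / (2 * p)
  have hb : b < 1 := (div_lt_one (by linarith)).2 hp'
  set K : ℝ≥0∞ := C ^ ((p - 2) / 2) * B ^ (p / 2)
  have hK : K ≠ ∞ := ENNReal.mul_ne_top (ENNReal.rpow_ne_top_of_nonneg (by linarith) hC)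
    (ENNReal.rpow_ne_top_of_nonneg (by linarith) hB)
  set D : ℝ → ℝ≥0∞ := fun h => (∫⁻ s in Set.Ioc 0 h, ENNReal.ofReal (s ^ (-b))) ^ p * K
  have hD : Tendsto D (𝓝[>] 0) (𝓝 0) := by
    have h1 := ((ENNReal.continuous_rpow_const (y := p)).tendsto 0).comp
      (tendsto_setLIntegral_Ioc_rpow hb)
    rw [ENNReal.zero_rpow_of_pos hp0] at h1
    simpa using ENNReal.Tendsto.mul_const h1 (Or.inr hK)
  have hle : ∀ {f : E → ℝ}, Differentiable ℝ f → ∫⁻ x, ‖fderiv ℝ f x‖ₑ ^ (2 : ℝ) ∂μ ≤ B →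
      ∀ {h : ℝ}, 0 < h → ∫⁻ x, ‖f x - scaledAverage ν h f x‖ₑ ^ p ∂μ ≤ D h := by
    intro f hf hfB h hh
    refine (lintegral_rpow_sub_scaledAverage_le μ hν hν1 hf hp hh.le).trans ?_
    refine mul_le_mul' le_rfl (mul_le_mul' le_rfl (ENNReal.rpow_le_rpow hfB (by linarith)))
  have hsmall : ∀ {l : ℝ≥0∞ → ℝ≥0∞}, Tendsto l (𝓝 0) (𝓝 0) → ∀ η : ℝ≥0∞, 0 < η →
      ∃ h : ℝ, 0 < h ∧ h ≤ 1 ∧ l (D h) ≤ η := by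
    intro l hl η hη
    have h1 := (hl.comp hD).eventually (Iic_mem_nhds hη)
    have h2 : ∀ᶠ h : ℝ in 𝓝[>] 0, h ∈ Set.Ioc (0 : ℝ) 1 := Ioc_mem_nhdsGT one_pos
    obtain ⟨h, hh1, hh2⟩ := (h1.and h2).exists
    exact ⟨h, hh2.1, hh2.2, hh1⟩
  have hSm : ∀ {f : E → ℝ}, Differentiable ℝ f → ∀ h, Measurable (scaledAverage ν h f) :=
    fun hf h => measurable_scaledAverage hf.continuous h
  have hum : ∀ n, Measurable (u n) := fun n => (hu n).continuous.measurable
  have hu₀m : Measurable u₀ := hu₀.continuous.measurable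
  set κ : ℝ≥0∞ := 2 ^ (p - 1)
  have hκ : κ ≠ ∞ := ENNReal.rpow_ne_top_of_nonneg (by linarith) (by simp)
  have hp1 : 1 ≤ p := by linarith
  constructor
  · rw [ENNReal.tendsto_nhds_zero]
    intro η hη
    have hη2 : 0 < η / 2 := ENNReal.half_pos hη.ne'
    have hl : Tendsto (fun t : ℝ≥0∞ => κ * (t + κ * t)) (𝓝 0) (𝓝 0) := by
      have h1 : Tendsto (fun t : ℝ≥0∞ => t) (𝓝 0) (𝓝 0) := tendsto_id
      have := ENNReal.Tendsto.const_mul (h1.add (ENNReal.Tendsto.const_mul h1 (Or.inr hκ)))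
        (Or.inr hκ)
      simpa using this
    obtain ⟨h, hh, hh1, hhη⟩ := hsmall hl _ hη2
    have hlim : ∀ x, Tendsto (fun n => scaledAverage ν h (u n) x) atTop
        (𝓝 (scaledAverage ν h u₀ x)) := fun x => by
      obtain ⟨φ, hφ, hφc, hφe⟩ := htest h hh x
      simpa only [hφe] using hweak φ hφ hφc
    have hmid := tendsto_lintegral_rpow_scaledAverage_sub μ hC hν hν1
      (fun n => (hu n).continuous) hu₀.continuous hB hu2 hu₀2 hvan hh hh1 hlim hp
    have hmid' := ENNReal.Tendsto.const_mul hmid (Or.inr (ENNReal.mul_ne_top hκ hκ))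
    rw [mul_zero] at hmid'
    filter_upwards [hmid'.eventually (Iic_mem_nhds hη2)] with n hn
    have hS := hSm (hu n) h
    have hS₀ := hSm hu₀ h
    calc ∫⁻ x, ‖u n x - u₀ x‖ₑ ^ p ∂μ
        = ∫⁻ x, ‖(u n x - scaledAverage ν h (u n) x) - ((u₀ x - scaledAverage ν h u₀ x) -
            (scaledAverage ν h (u n) x - scaledAverage ν h u₀ x))‖ₑ ^ p ∂μ := by
          congr 1; ext x; congr 2; ring
      _ ≤ κ * (D h + κ * (D h +
            ∫⁻ x, ‖scaledAverage ν h (u n) x - scaledAverage ν h u₀ x‖ₑ ^ p ∂μ)) := by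
          refine (lintegral_enorm_sub_rpow_le μ ((hum n).sub hS)
            ((hu₀m.sub hS₀).sub (hS.sub hS₀)) hp1).trans ?_
          refine mul_le_mul' le_rfl (add_le_add (hle (hu n) (hg n) hh) ?_)
          refine (lintegral_enorm_sub_rpow_le μ (hu₀m.sub hS₀) (hS.sub hS₀) hp1).trans ?_
          exact mul_le_mul' le_rfl (add_le_add (hle hu₀ hg₀ hh) le_rfl)
      _ = κ * (D h + κ * D h) + κ * κ *
            ∫⁻ x, ‖scaledAverage ν h (u n) x - scaledAverage ν h u₀ x‖ₑ ^ p ∂μ := by ring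
      _ ≤ η / 2 + η / 2 := add_le_add hhη hn
      _ = η := ENNReal.add_halves η
  · obtain ⟨h, hh, hh1, hh2⟩ := hsmall (l := fun t => t) tendsto_id 1 one_pos
    have hS₀ := hSm hu₀ h
    have hSp : ∫⁻ x, ‖scaledAverage ν h u₀ x‖ₑ ^ p ∂μ ≠ ∞ := by
      refine ne_top_of_le_ne_top ?_ (lintegral_rpow_le_mul_lintegral_sq μ hp.le hS₀.enorm
        (Eventually.of_forall fun x =>
          enorm_scaledAverage_le μ hν hν1 hu₀.continuous x hh hh1 hu₀2))
      refine ENNReal.mul_ne_top (ENNReal.rpow_ne_top_of_nonneg (by linarith)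
        (ENNReal.rpow_ne_top_of_nonneg (by norm_num)
          (ENNReal.mul_ne_top (ENNReal.mul_ne_top hC ENNReal.ofReal_ne_top) hB))) ?_
      exact ne_top_of_le_ne_top hB
        ((lintegral_sq_scaledAverage_le μ hu₀.continuous h).trans hu₀2)
    have h1 := lintegral_enorm_sub_rpow_le μ (hu₀m.sub hS₀) hS₀.neg hp1
    simp only [Pi.sub_apply, Pi.neg_apply, sub_neg_eq_add, sub_add_cancel, enorm_neg] at h1
    refine ne_top_of_le_ne_top (ENNReal.mul_ne_top hκ (ENNReal.add_ne_top.2 ⟨?_, hSp⟩)) h1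
    exact ne_top_of_le_ne_top ENNReal.one_ne_top ((hle hu₀ hg₀ hh).trans hh2)

end Compactness

lemma lintegral_enorm_sq_eq {α G : Type*} [MeasurableSpace α] [NormedAddCommGroup G]
    {μ : Measure α} {f : α → G} (hf : Integrable (fun x => ‖f x‖ ^ 2) μ) :
    ∫⁻ x, ‖f x‖ₑ ^ (2 : ℝ) ∂μ = ENNReal.ofReal (∫ x, ‖f x‖ ^ 2 ∂μ) := by
  rw [ofReal_integral_eq_lintegral_ofReal hf (Eventually.of_forall fun x => by positivity)]
  refine lintegral_congr fun x => ?_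
  rw [ENNReal.ofReal_pow (norm_nonneg _), ofReal_norm]
  exact ENNReal.rpow_natCast _ 2

/-- Compactness of the nonlinear term (Lemma 13): if `(uₙ) ⊂ H¹(ℝ^N)` is
bounded, the `L²` mass in unit balls far from the origin is uniformly small,
`|F(t)| ≤ M(|t|^p + |t|^q)` with `2 < p, q < 2N/(N−2)`, `F` continuous, and
`uₙ ⇀ u₀` weakly in `H¹(ℝ^N)` (tested against `C₀^∞` functions), then
`∫ F(uₙ) → ∫ F(u₀)`. -/
theorem stmt_19 (N : ℕ) (hN : 3 ≤ N)
    (u : ℕ → EuclideanSpace ℝ (Fin N) → ℝ) (u₀ : EuclideanSpace ℝ (Fin N) → ℝ)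
    (hdiff : ∀ n, Differentiable ℝ (u n)) (hdiff₀ : Differentiable ℝ u₀)
    (hu2 : ∀ n, Integrable fun x => (u n x) ^ 2)
    (hgrad : ∀ n, Integrable fun x => ‖fderiv ℝ (u n) x‖ ^ 2)
    (hu₀2 : Integrable fun x => (u₀ x) ^ 2)
    (hgrad₀ : Integrable fun x => ‖fderiv ℝ u₀ x‖ ^ 2)
    (B : ℝ)
    (hbdd : ∀ n, (∫ x, (u n x) ^ 2) + (∫ x, ‖fderiv ℝ (u n) x‖ ^ 2) ≤ B)
    (hvanish : ∀ ε : ℝ, 0 < ε → ∃ R : ℝ, 0 < R ∧ ∃ n₀ : ℕ, ∀ n ≥ n₀,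
      ∀ x : EuclideanSpace ℝ (Fin N), R ≤ ‖x‖ →
        (∫ y in Metric.ball x 1, (u n y) ^ 2) ≤ ε)
    (F : ℝ → ℝ) (hFc : Continuous F)
    (M p q : ℝ) (hM : 0 < M)
    (hp : 2 < p) (hp' : p < 2 * N / ((N:ℝ) - 2))
    (hq : 2 < q) (hq' : q < 2 * N / ((N:ℝ) - 2))
    (hFb : ∀ s : ℝ, |F s| ≤ M * (|s| ^ p + |s| ^ q))
    (hFu : ∀ n, Integrable fun x => F (u n x))
    (hFu₀ : Integrable fun x => F (u₀ x))
    (hweak : ∀ φ : EuclideanSpace ℝ (Fin N) → ℝ, ContDiff ℝ (⊤ : ℕ∞) φ →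
      HasCompactSupport φ →
      Tendsto (fun n => ∫ x, u n x * φ x) atTop (nhds (∫ x, u₀ x * φ x)) ∧
      Tendsto (fun n => ∫ x, (fderiv ℝ (u n) x) (gradient φ x)) atTop
        (nhds (∫ x, (fderiv ℝ u₀ x) (gradient φ x)))) :
    Tendsto (fun n => ∫ x, F (u n x)) atTop (nhds (∫ x, F (u₀ x))) := by
  have hu2' : ∀ n, Integrable fun x => ‖u n x‖ ^ 2 := fun n => by simpa using hu2 n
  have hu₀2' : Integrable fun x => ‖u₀ x‖ ^ 2 := by simpa using hu₀2
  set B' : ℝ := max B ((∫ x, ‖u₀ x‖ ^ 2) + ∫ x, ‖fderiv ℝ u₀ x‖ ^ 2)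
  have hnn : ∀ {G : Type} [NormedAddCommGroup G] (f : EuclideanSpace ℝ (Fin N) → G),
      0 ≤ ∫ x, ‖f x‖ ^ 2 := fun f => integral_nonneg fun x => by positivity
  have hbdd' : ∀ n, (∫ x, ‖u n x‖ ^ 2) + (∫ x, ‖fderiv ℝ (u n) x‖ ^ 2) ≤ B' := fun n => by
    refine le_trans ?_ (le_max_left _ _)
    simpa using hbdd n
  have hbdd₀ : (∫ x, ‖u₀ x‖ ^ 2) + (∫ x, ‖fderiv ℝ u₀ x‖ ^ 2) ≤ B' := le_max_right _ _
  have hvan : ∀ ε : ℝ≥0∞, 0 < ε → ∃ R : ℝ, ∀ᶠ n in atTop, ∀ x : EuclideanSpace ℝ (Fin N),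
      R ≤ ‖x‖ → ∫⁻ y in Metric.ball x 1, ‖u n y‖ₑ ^ (2 : ℝ) ≤ ε := by
    intro ε hε
    obtain ⟨δ, hδ, hδε⟩ := ENNReal.lt_iff_exists_nnreal_btwn.1 hε
    obtain ⟨R, -, n₀, h⟩ := hvanish δ (by exact_mod_cast hδ)
    refine ⟨R, (eventually_ge_atTop n₀).mono fun n hn x hx => ?_⟩
    rw [lintegral_enorm_sq_eq (hu2' n).integrableOn]
    refine le_trans ?_ hδε.le
    rw [← ENNReal.ofReal_coe_nnreal]
    refine ENNReal.ofReal_le_ofReal ?_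
    simpa using h n hn x hx
  have hN2 : (0 : ℝ) < N - 2 := by
    have : (3 : ℝ) ≤ N := by exact_mod_cast hN
    linarith
  have hconv : ∀ r : ℝ, 2 < r → r < 2 * N / ((N : ℝ) - 2) → _ := fun r hr hr' =>
    tendsto_lintegral_rpow_sub volume hdiff hdiff₀ (B := ENNReal.ofReal B') ENNReal.ofReal_ne_top
      (fun n => by
        rw [lintegral_enorm_sq_eq (hu2' n)]
        exact ENNReal.ofReal_le_ofReal
          ((le_add_of_nonneg_right (hnn (fderiv ℝ (u n)))).trans (hbdd' n)))
      (by
        rw [lintegral_enorm_sq_eq hu₀2']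
        exact ENNReal.ofReal_le_ofReal
          ((le_add_of_nonneg_right (hnn (fderiv ℝ u₀))).trans hbdd₀))
      (fun n => by
        rw [lintegral_enorm_sq_eq (hgrad n)]
        exact ENNReal.ofReal_le_ofReal ((le_add_of_nonneg_left (hnn (u n))).trans (hbdd' n)))
      (by
        rw [lintegral_enorm_sq_eq hgrad₀]
        exact ENNReal.ofReal_le_ofReal ((le_add_of_nonneg_left (hnn u₀)).trans hbdd₀))
      hvan (fun φ hφ hφc => (hweak φ hφ hφc).1) hr
      (by
        rw [lt_div_iff₀ hN2] at hr'
        rw [finrank_euclideanSpace_fin]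
        linarith)
  refine tendsto_integral_comp_of_tendsto_lintegral_rpow volume
    (fun n => (hdiff n).continuous.measurable) hdiff₀.continuous.measurable hFc
    (m := ENNReal.ofReal M) ENNReal.ofReal_ne_top (p := p) (q := q) (by linarith) (by linarith)
    (fun s => ?_) hFu (hconv p hp hp').1 (hconv q hq hq').1 (hconv p hp hp').2 (hconv q hq hq').2
  rw [← ofReal_norm, ← ofReal_norm, ENNReal.ofReal_rpow_of_nonneg (norm_nonneg _) (by linarith),
    ENNReal.ofReal_rpow_of_nonneg (norm_nonneg _) (by linarith),
    ← ENNReal.ofReal_add (by positivity) (by positivity), ← ENNReal.ofReal_mul hM.le]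
  exact ENNReal.ofReal_le_ofReal (hFb s)
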